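/- arXiv:2308.11118 — 2 statements merged into one kernel-verified Lean document; each statement's English description precedes it below -/
import Mathlib

section
/- Let m ≥ 1 and h ≥ 2 be integers, let x be a ruler of length t with m+1 markings, and let z_i = x_i − x_{i−1} for 1 ≤ i ≤ m. Then x is a B_h-set if and only if for every integer h' with 2 ≤ h' ≤ h, every integer ℓ with 1 ≤ ℓ ≤ h'−1, and every choice of proper consecutive subsets U_1, ..., U_{h'} of [m] such that the sum of the indicator vectors of U_1, ..., U_ℓ differs from the sum of the indicator vectors of U_{ℓ+1}, ..., U_{h'} (as vectors in ℕ^m), one has Σ_{k=1}^{ℓ} Σ_{j∈U_k} z_j ≠ Σ_{k=ℓ+1}^{h'} Σ_{j∈U_k} z_j. -/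
/-- A ruler of length `t` with `m+1` markings, given as `x : ℕ → ℤ` with
`0 = x 0 < x 1 < ⋯ < x m = t`. -/
def IsRuler (m : ℕ) (t : ℤ) (x : ℕ → ℤ) : Prop :=
  x 0 = 0 ∧ x m = t ∧ ∀ i < m, x i < x (i + 1)

/-- A ruler is a `B_h`-set if any two distinct multisets of `h` markings (indices in
`{0,…,m}`) have distinct sums. -/
def IsBhSet (m h : ℕ) (x : ℕ → ℤ) : Prop :=
  ∀ r s : Multiset ℕ, Multiset.card r = h → Multiset.card s = h →
    (∀ i ∈ r, i ≤ m) → (∀ i ∈ s, i ≤ m) → r ≠ s →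
    (r.map x).sum ≠ (s.map x).sum

/-- A consecutive subset of `[m] = {1,…,m}`. -/
def IsConsec (m : ℕ) (U : Finset ℕ) : Prop :=
  ∃ i j : ℕ, 1 ≤ i ∧ i ≤ j ∧ j ≤ m ∧ U = Finset.Icc i j

theorem sum_Icc_succ_eq_sub_of_differences {m : ℕ} {x z : ℕ → ℤ}
    (hz : ∀ i, 1 ≤ i → i ≤ m → z i = x i - x (i - 1)) {a b : ℕ} (hab : a ≤ b) (hb : b ≤ m) :
    ∑ j ∈ Finset.Icc (a + 1) b, z j = x b - x a := by
  induction b, hab using Nat.le_induction with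
  | base => simp
  | succ n hn ih =>
    rw [Finset.sum_Icc_succ_top (by omega), ih (by omega), hz (n + 1) (by omega) hb]
    simp

theorem indicator_Icc_succ_add {a b : ℕ} (hab : a ≤ b) (i : ℕ) :
    (if i ∈ Finset.Icc (a + 1) b then 1 else 0 : ℕ) + (if i ≤ a then 1 else 0) =
      if i ≤ b then 1 else 0 := by
  simp only [Finset.mem_Icc]
  split_ifs <;> omega

theorem Multiset.eq_of_sum_indicator_le_eq {r s : Multiset ℕ}
    (H : ∀ i, (r.map fun a => if i ≤ a then 1 else (0 : ℕ)).sum =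
      (s.map fun a => if i ≤ a then 1 else (0 : ℕ)).sum) : r = s := by
  have key : ∀ (u : Multiset ℕ) (i : ℕ),
      u.count i + (u.map fun a => if i + 1 ≤ a then 1 else (0 : ℕ)).sum =
        (u.map fun a => if i ≤ a then 1 else (0 : ℕ)).sum := by
    intro u i
    induction u using Multiset.induction_on with
    | empty => simp
    | cons a u ih =>
      simp only [Multiset.count_cons, Multiset.map_cons, Multiset.sum_cons]
      rw [← ih]
      split_ifs <;> omega
  ext i
  have h1 := key r i
  have h2 := key s i
  rw [H i, H (i + 1)] at h1
  omega

theorem Multiset.exists_monotone_fin_map_eq {h : ℕ} {r : Multiset ℕ}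
    (hr : Multiset.card r = h) :
    ∃ f : Fin h → ℕ, Monotone f ∧ r = Finset.univ.val.map f := by
  subst hr
  have hl : (r.sort (· ≤ ·)).length = Multiset.card r := Multiset.length_sort _
  rw [← hl]
  refine ⟨(r.sort (· ≤ ·)).get, ?_, ?_⟩
  · exact (Multiset.pairwise_sort r (· ≤ ·)).sortedLE.monotone_get
  · rw [Fin.univ_val_map, List.ofFn_get, Multiset.sort_eq]

theorem Finset.exists_bijOn_range_bijOn_Ico {ι : Type*} [Nonempty ι] (P N : Finset ι) :
    ∃ e : ℕ → ι, Set.BijOn e (Finset.range P.card) P ∧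
      Set.BijOn e (Finset.Ico P.card (P.card + N.card)) N := by
  obtain ⟨e₁, h₁⟩ := (Finset.range P.card).finite_toSet.exists_bijOn_of_encard_eq
    (t := (P : Set ι)) (by rw [Set.encard_coe_eq_coe_finsetCard,
      Set.encard_coe_eq_coe_finsetCard, Finset.card_range])
  obtain ⟨e₂, h₂⟩ := (Finset.Ico P.card (P.card + N.card)).finite_toSet.exists_bijOn_of_encard_eq
    (t := (N : Set ι)) (by rw [Set.encard_coe_eq_coe_finsetCard,
      Set.encard_coe_eq_coe_finsetCard, Nat.card_Ico, Nat.add_sub_cancel_left])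
  refine ⟨fun k => if k < P.card then e₁ k else e₂ k, h₁.congr ?_, h₂.congr ?_⟩
  · intro k hk
    have : k < P.card := by simpa using hk
    simp [this]
  · intro k hk
    have : P.card ≤ k := by
      have := Finset.mem_Ico.1 (Finset.mem_coe.1 hk)
      exact this.1
    simp [this]

theorem Set.BijOn.sum_comp {ι κ M : Type*} [AddCommMonoid M] {s : Finset ι} {t : Finset κ}
    {e : ι → κ} (he : Set.BijOn e s t) (F : κ → M) : ∑ k ∈ s, F (e k) = ∑ k ∈ t, F k :=
  Finset.sum_nbij e (fun _ hk => he.mapsTo hk) he.injOn he.surjOn fun _ _ => rfl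

theorem Finset.sum_filter_max_sub_min {ι : Type*} (s : Finset ι) (f g : ι → ℕ) (F : ℕ → ℤ) :
    ∑ k ∈ s with g k < f k, (F (max (f k) (g k)) - F (min (f k) (g k))) -
      ∑ k ∈ s with f k < g k, (F (max (f k) (g k)) - F (min (f k) (g k))) =
    ∑ k ∈ s, F (f k) - ∑ k ∈ s, F (g k) := by
  rw [Finset.sum_filter, Finset.sum_filter, ← Finset.sum_sub_distrib, ← Finset.sum_sub_distrib]
  refine Finset.sum_congr rfl fun k _ => ?_
  rcases lt_trichotomy (f k) (g k) with hk | hk | hk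
  · simp [hk, hk.le, hk.not_gt]
  · simp [hk]
  · simp [hk, hk.le, hk.not_gt]

theorem IsRuler.strictMonoOn {m : ℕ} {t : ℤ} {x : ℕ → ℤ} (hx : IsRuler m t x) :
    StrictMonoOn x (Set.Iic m) := by
  intro a _ b hb hab
  induction b, Nat.succ_le_of_lt hab using Nat.le_induction with
  | base => exact hx.2.2 a hb
  | succ n hn ih =>
    have hnm : n + 1 ≤ m := hb
    exact (ih (show n ≤ m by omega) (by omega)).trans (hx.2.2 n hnm)

/-- Two families of markings with equal sums that are comparable entrywise coincide. -/
theorem IsRuler.eq_of_le_of_sum_eq {m : ℕ} {t : ℤ} {x : ℕ → ℤ} (hx : IsRuler m t x)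
    {ι : Type*} [Fintype ι] {f g : ι → ℕ} (hg : ∀ k, g k ≤ m)
    (hfg : ∀ k, f k ≤ g k) (hsum : ∑ k, x (f k) = ∑ k, x (g k)) : f = g := by
  have hmem : ∀ k, f k ∈ Set.Iic m := fun k => (hfg k).trans (hg k)
  have hle : ∀ k ∈ Finset.univ, x (f k) ≤ x (g k) := fun k _ =>
    hx.strictMonoOn.monotoneOn (hmem k) (hg k) (hfg k)
  funext k
  exact hx.strictMonoOn.injOn (hmem k) (hg k)
    ((Finset.sum_eq_sum_iff_of_le hle).1 hsum k (Finset.mem_univ k))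

theorem IsBhSet.avoids_hyperplane {m h : ℕ} {x z : ℕ → ℤ} (hB : IsBhSet m h x)
    (hz : ∀ i, 1 ≤ i → i ≤ m → z i = x i - x (i - 1)) {h' l : ℕ} (hh' : h' ≤ h) (hl : l ≤ h')
    {U : ℕ → Finset ℕ} (hU : ∀ k < h', IsConsec m (U k))
    (hne : (fun i => ∑ k ∈ Finset.range l, (if i ∈ U k then 1 else 0 : ℕ)) ≠
      (fun i => ∑ k ∈ Finset.Ico l h', (if i ∈ U k then 1 else 0 : ℕ))) :
    ∑ k ∈ Finset.range l, ∑ j ∈ U k, z j ≠ ∑ k ∈ Finset.Ico l h', ∑ j ∈ U k, z j := by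
  have hab : ∀ k, ∃ a b : ℕ, k < h' → a ≤ b ∧ b ≤ m ∧ U k = Finset.Icc (a + 1) b := by
    intro k
    by_cases hk : k < h'
    · obtain ⟨i, j, hi, hij, hj, hUk⟩ := hU k hk
      exact ⟨i - 1, j, fun _ => ⟨by omega, hj, by rw [hUk, Nat.sub_add_cancel hi]⟩⟩
    · exact ⟨0, 0, fun hk' => absurd hk' hk⟩
  choose a b hab using hab
  have hlt₁ : ∀ k ∈ Finset.range l, k < h' := fun k hk => (Finset.mem_range.1 hk).trans_le hl
  have hlt₂ : ∀ k ∈ Finset.Ico l h', k < h' := fun k hk => (Finset.mem_Ico.1 hk).2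
  let R (c d : ℕ → ℕ) : Multiset ℕ :=
    (Finset.range l).val.map c + (Finset.Ico l h').val.map d + Multiset.replicate (h - h') 0
  have card_R : ∀ c d, Multiset.card (R c d) = h := by
    intro c d
    simp [R]
    omega
  have mem_R : ∀ c d : ℕ → ℕ, (∀ k < h', c k ≤ m) → (∀ k < h', d k ≤ m) →
      ∀ i ∈ R c d, i ≤ m := by
    intro c d hc hd i hi
    simp only [R, Multiset.mem_add, Multiset.mem_map, Finset.mem_val] at hi
    rcases hi with (⟨k, hk, rfl⟩ | ⟨k, hk, rfl⟩) | hi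
    · exact hc k (hlt₁ k hk)
    · exact hd k (hlt₂ k hk)
    · rw [Multiset.eq_of_mem_replicate hi]
      exact Nat.zero_le m
  have ha : ∀ k < h', a k ≤ m := fun k hk => (hab k hk).1.trans (hab k hk).2.1
  have hb : ∀ k < h', b k ≤ m := fun k hk => (hab k hk).2.1
  have sum_R_nat : ∀ (c d : ℕ → ℕ) (F : ℕ → ℕ), ((R c d).map F).sum =
      ∑ k ∈ Finset.range l, F (c k) + ∑ k ∈ Finset.Ico l h', F (d k) + (h - h') * F 0 := by
    intro c d F
    simp only [R, Finset.sum, Multiset.map_add, Multiset.sum_add, Multiset.map_map,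
      Multiset.map_replicate, Multiset.sum_replicate, Function.comp_def, smul_eq_mul]
  have sum_R_int : ∀ (c d : ℕ → ℕ) (F : ℕ → ℤ), ((R c d).map F).sum =
      ∑ k ∈ Finset.range l, F (c k) + ∑ k ∈ Finset.Ico l h', F (d k) + (h - h') • F 0 := by
    intro c d F
    simp only [R, Finset.sum, Multiset.map_add, Multiset.sum_add, Multiset.map_map,
      Multiset.map_replicate, Multiset.sum_replicate, Function.comp_def]
  have hRne : R b a ≠ R a b := by
    intro hR
    refine hne (funext fun i => ?_)
    have hF := congrArg (fun u => (u.map fun j => if i ≤ j then 1 else (0 : ℕ)).sum) hR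
    simp only [sum_R_nat] at hF
    have hind : ∀ k < h', (if i ∈ U k then 1 else 0 : ℕ) + (if i ≤ a k then 1 else 0) =
        if i ≤ b k then 1 else 0 := by
      intro k hk
      rw [(hab k hk).2.2]
      exact indicator_Icc_succ_add (hab k hk).1 i
    have h₁ := Finset.sum_congr rfl fun k hk => hind k (hlt₁ k hk)
    have h₂ := Finset.sum_congr rfl fun k hk => hind k (hlt₂ k hk)
    rw [Finset.sum_add_distrib] at h₁ h₂
    omega
  intro hsum
  refine hB (R b a) (R a b) (card_R _ _) (card_R _ _) (mem_R _ _ hb ha) (mem_R _ _ ha hb)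
    hRne ?_
  have hdiff : ∀ k < h', ∑ j ∈ U k, z j = x (b k) - x (a k) := by
    intro k hk
    rw [(hab k hk).2.2]
    exact sum_Icc_succ_eq_sub_of_differences hz (hab k hk).1 (hab k hk).2.1
  rw [Finset.sum_congr rfl fun k hk => hdiff k (hlt₁ k hk),
    Finset.sum_congr rfl fun k hk => hdiff k (hlt₂ k hk),
    Finset.sum_sub_distrib, Finset.sum_sub_distrib] at hsum
  rw [sum_R_int, sum_R_int]
  linarith

/-- Distinct multisets of markings with equal sums, paired in sorted order, yield a coincidence
between sums over proper consecutive subsets. -/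
theorem IsRuler.exists_consec_sum_eq {m h : ℕ} {t : ℤ} {x z : ℕ → ℤ} (hx : IsRuler m t x)
    (hz : ∀ i, 1 ≤ i → i ≤ m → z i = x i - x (i - 1)) {r s : Multiset ℕ}
    (hr : Multiset.card r = h) (hs : Multiset.card s = h)
    (hrm : ∀ i ∈ r, i ≤ m) (hsm : ∀ i ∈ s, i ≤ m) (hrs : r ≠ s)
    (hsum : (r.map x).sum = (s.map x).sum) :
    ∃ h' l : ℕ, 2 ≤ h' ∧ h' ≤ h ∧ 1 ≤ l ∧ l ≤ h' - 1 ∧ ∃ U : ℕ → Finset ℕ,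
      (∀ k < h', IsConsec m (U k) ∧ U k ≠ Finset.Icc 1 m) ∧
      (fun i => ∑ k ∈ Finset.range l, (if i ∈ U k then 1 else 0 : ℕ)) ≠
        (fun i => ∑ k ∈ Finset.Ico l h', (if i ∈ U k then 1 else 0 : ℕ)) ∧
      ∑ k ∈ Finset.range l, ∑ j ∈ U k, z j = ∑ k ∈ Finset.Ico l h', ∑ j ∈ U k, z j := by
  obtain ⟨f, hf, rfl⟩ := Multiset.exists_monotone_fin_map_eq hr
  obtain ⟨g, hg, rfl⟩ := Multiset.exists_monotone_fin_map_eq hs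
  have hfm : ∀ k, f k ≤ m := fun k => hrm _ (Multiset.mem_map_of_mem f (Finset.mem_univ k))
  have hgm : ∀ k, g k ≤ m := fun k => hsm _ (Multiset.mem_map_of_mem g (Finset.mem_univ k))
  have hsum' : ∑ k, x (f k) = ∑ k, x (g k) := by
    simpa only [Multiset.map_map, Finset.sum, Function.comp_def] using hsum
  have hfg : ¬ ∀ k, f k ≤ g k := fun hle => hrs (by rw [hx.eq_of_le_of_sum_eq hgm hle hsum'])
  have hgf : ¬ ∀ k, g k ≤ f k := fun hle =>
    hrs (by rw [hx.eq_of_le_of_sum_eq hfm hle hsum'.symm])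
  let P : Finset (Fin h) := {k | g k < f k}
  let N : Finset (Fin h) := {k | f k < g k}
  have hP : 0 < P.card := by
    push Not at hfg
    obtain ⟨k, hk⟩ := hfg
    exact Finset.card_pos.2 ⟨k, by simpa [P] using hk⟩
  have hN : 0 < N.card := by
    push Not at hgf
    obtain ⟨k, hk⟩ := hgf
    exact Finset.card_pos.2 ⟨k, by simpa [N] using hk⟩
  have hPN : P.card + N.card ≤ h := by
    have hdisj : Disjoint P N := Finset.disjoint_left.2 fun k hk hk' => by
      simp only [P, N, Finset.mem_filter] at hk hk'
      omega
    rw [← Finset.card_union_of_disjoint hdisj]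
    exact (Finset.card_le_univ _).trans (by simp)
  have hnon : Nonempty (Fin h) := ⟨(Finset.card_pos.1 hP).choose⟩
  obtain ⟨e, heP, heN⟩ := Finset.exists_bijOn_range_bijOn_Ico P N
  let V (k : Fin h) : Finset ℕ := Finset.Icc (min (f k) (g k) + 1) (max (f k) (g k))
  have hne : ∀ k < P.card + N.card, f (e k) ≠ g (e k) := by
    intro k hk
    by_cases hkP : k < P.card
    · have hmem : e k ∈ P := heP.mapsTo (by simpa using hkP)
      simp only [P, Finset.mem_filter] at hmem
      omega
    · have hmem : e k ∈ N := heN.mapsTo (Finset.mem_coe.2 (Finset.mem_Ico.2 ⟨by omega, hk⟩))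
      simp only [N, Finset.mem_filter] at hmem
      omega
  refine ⟨P.card + N.card, P.card, by omega, hPN, hP, by omega, fun k => V (e k), ?_, ?_, ?_⟩
  · intro k hk
    have hk' := hne k hk
    have hfk := hfm (e k)
    have hgk := hgm (e k)
    refine ⟨⟨_, _, by omega, by omega, by omega, rfl⟩, fun (hV : V (e k) = _) => ?_⟩
    have h1 : 1 ∈ V (e k) := by
      rw [hV, Finset.mem_Icc]
      omega
    have h2 : m ∈ V (e k) := by
      rw [hV, Finset.mem_Icc]
      omega
    simp only [V, Finset.mem_Icc] at h1 h2
    rcases Nat.lt_or_gt_of_ne hk' with hlt | hlt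
    · refine hfg fun i => ?_
      rcases le_total i (e k) with hi | hi
      · have := hf hi
        omega
      · have := hg hi
        have := hfm i
        omega
    · refine hgf fun i => ?_
      rcases le_total i (e k) with hi | hi
      · have := hg hi
        omega
      · have := hf hi
        have := hgm i
        omega
  · intro hind
    refine hrs (Multiset.eq_of_sum_indicator_le_eq fun i => ?_)
    have hi := congrFun hind i
    simp only at hi
    rw [heP.sum_comp fun k => if i ∈ V k then 1 else 0,
      heN.sum_comp fun k => if i ∈ V k then 1 else 0] at hi
    have hV : ∀ k, ((if i ∈ V k then 1 else 0 : ℕ) : ℤ) =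
        (if i ≤ max (f k) (g k) then 1 else 0) - (if i ≤ min (f k) (g k) then 1 else 0) := by
      intro k
      have := indicator_Icc_succ_add (min_le_max (a := f k) (b := g k)) i
      rw [eq_sub_iff_add_eq]
      exact_mod_cast this
    have hi' : ((∑ k ∈ P, if i ∈ V k then 1 else 0 : ℕ) : ℤ) =
      ((∑ k ∈ N, if i ∈ V k then 1 else 0 : ℕ) : ℤ) := congrArg _ hi
    rw [Nat.cast_sum, Nat.cast_sum, Finset.sum_congr rfl fun k _ => hV k,
      Finset.sum_congr rfl fun k _ => hV k, ← sub_eq_zero,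
      Finset.sum_filter_max_sub_min Finset.univ f g fun j => if i ≤ j then 1 else 0,
      sub_eq_zero] at hi'
    simp only [Multiset.map_map, Function.comp_def]
    exact_mod_cast hi'
  · rw [heP.sum_comp fun k => ∑ j ∈ V k, z j, heN.sum_comp fun k => ∑ j ∈ V k, z j]
    have hV : ∀ k, ∑ j ∈ V k, z j = x (max (f k) (g k)) - x (min (f k) (g k)) := fun k =>
      sum_Icc_succ_eq_sub_of_differences hz min_le_max (max_le (hfm k) (hgm k))
    rw [Finset.sum_congr rfl fun k _ => hV k, Finset.sum_congr rfl fun k _ => hV k,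
      ← sub_eq_zero, Finset.sum_filter_max_sub_min Finset.univ f g x, sub_eq_zero]
    exact hsum'

/-- A ruler `x` with successive differences `z` is a `B_h`-set iff for every `2 ≤ h' ≤ h`,
every `1 ≤ ℓ ≤ h' - 1`, and every choice of proper consecutive subsets `U 0, …, U (h'-1)`
of `[m]` whose first `ℓ` indicator vectors and last `h' - ℓ` indicator vectors have
different sums in `ℕ^m`, the corresponding sums of the `z_j` differ. -/
theorem isBhSet_iff_avoids_hyperplanes (m h : ℕ) (hm : 1 ≤ m) (hh : 2 ≤ h)
    (t : ℤ) (x z : ℕ → ℤ) (hx : IsRuler m t x)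
    (hz : ∀ i, 1 ≤ i → i ≤ m → z i = x i - x (i - 1)) :
    IsBhSet m h x ↔
      ∀ h' : ℕ, 2 ≤ h' → h' ≤ h → ∀ l : ℕ, 1 ≤ l → l ≤ h' - 1 →
        ∀ U : ℕ → Finset ℕ,
          (∀ k < h', IsConsec m (U k) ∧ U k ≠ Finset.Icc 1 m) →
          (fun i => ∑ k ∈ Finset.range l, (if i ∈ U k then 1 else 0 : ℕ)) ≠
            (fun i => ∑ k ∈ Finset.Ico l h', (if i ∈ U k then 1 else 0 : ℕ)) →
          ∑ k ∈ Finset.range l, ∑ j ∈ U k, z j ≠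
            ∑ k ∈ Finset.Ico l h', ∑ j ∈ U k, z j := by
  constructor
  · intro hB h' _ hh' l _ hl U hU hne
    exact hB.avoids_hyperplane hz hh' (by omega) (fun k hk => (hU k hk).1) hne
  · intro H r s hr hs hrm hsm hrs hsum
    obtain ⟨h', l, h2, hh', hl, hl', U, hU, hne, heq⟩ :=
      hx.exists_consec_sum_eq hz hr hs hrm hsm hrs hsum
    exact H h' h2 hh' l hl hl' U hU hne heq
end

section
/- Let m ≥ 1 and g ≥ 1 be integers, let x be a ruler of length t with m+1 markings, and let z_i = x_i − x_{i−1} for 1 ≤ i ≤ m. Then x is a B_2[g]-set if and only if there do not exist indices 0 ≤ ℓ_0 < ℓ_1 < ... < ℓ_g ≤ r_g < r_{g−1} < ... < r_0 ≤ m such that the g+1 quantities S_k := Σ_{i=ℓ_0+1}^{ℓ_k} z_i + Σ_{i=r_g+1}^{r_k} z_i (for k = 0, 1, ..., g, with the convention that empty sums are zero) are all equal. -/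
/-- A ruler is a `B_2[g]`-set if every integer has at most `g` representations as a sum
`x i + x j` with `0 ≤ i ≤ j ≤ m`. -/
def IsB2gSet (m g : ℕ) (x : ℕ → ℤ) : Prop :=
  ∀ n : ℤ, {p : ℕ × ℕ | p.1 ≤ p.2 ∧ p.2 ≤ m ∧ x p.1 + x p.2 = n}.ncard ≤ g

theorem strictMonoOn_Iic_of_lt_add_one {α : Type*} [Preorder α] {f : ℕ → α} {n : ℕ}
    (hf : ∀ k < n, f k < f (k + 1)) : StrictMonoOn f (Set.Iic n) := by
  intro a _ b hb hab
  induction b, hab using Nat.le_induction with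
  | base => exact hf a hb
  | succ b _ ih => exact (ih (Nat.le_of_succ_le hb)).trans (hf b hb)

theorem strictAntiOn_Iic_of_add_one_lt {α : Type*} [Preorder α] {f : ℕ → α} {n : ℕ}
    (hf : ∀ k < n, f (k + 1) < f k) : StrictAntiOn f (Set.Iic n) :=
  strictMonoOn_Iic_of_lt_add_one (α := αᵒᵈ) hf

theorem sum_Icc_differences {m : ℕ} {x z : ℕ → ℤ}
    (hz : ∀ i, 1 ≤ i → i ≤ m → z i = x i - x (i - 1)) {a b : ℕ} (hab : a ≤ b) (hb : b ≤ m) :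
    ∑ i ∈ Finset.Icc (a + 1) b, z i = x b - x a := by
  induction b, hab using Nat.le_induction with
  | base => simp
  | succ b hab ih =>
    rw [Finset.sum_Icc_succ_top (by lia), ih (by lia), hz (b + 1) (by lia) hb, Nat.add_sub_cancel]
    ring

theorem finite_representations (m : ℕ) (x : ℕ → ℤ) (n : ℤ) :
    {p : ℕ × ℕ | p.1 ≤ p.2 ∧ p.2 ≤ m ∧ x p.1 + x p.2 = n}.Finite :=
  ((Set.finite_Iic m).prod (Set.finite_Iic m)).subset
    fun _ hp => ⟨hp.1.trans hp.2.1, hp.2.1⟩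

/-- Too many representations of an integer is the same as a nested chain of `g + 1` of them. -/
theorem not_isB2gSet_iff_exists_chain {m g : ℕ} {x : ℕ → ℤ} (hx : StrictMonoOn x (Set.Iic m)) :
    ¬ IsB2gSet m g x ↔
      ∃ l r : ℕ → ℕ,
        (∀ k < g, l k < l (k + 1)) ∧ l g ≤ r g ∧ (∀ k < g, r (k + 1) < r k) ∧ r 0 ≤ m ∧
        ∀ k ≤ g, x (l k) + x (r k) = x (l 0) + x (r 0) := by
  constructor
  · intro h
    obtain ⟨n, hn⟩ := not_forall.mp h
    rw [not_le] at hn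
    set T := {p : ℕ × ℕ | p.1 ≤ p.2 ∧ p.2 ≤ m ∧ x p.1 + x p.2 = n} with hT
    have hfin : T.Finite := finite_representations m x n
    have hinj : Set.InjOn Prod.fst T := by
      rintro ⟨a, b⟩ ⟨_, hb, hab⟩ ⟨c, d⟩ ⟨_, hd, hcd⟩ rfl
      exact Prod.ext rfl (hx.injOn hb hd (by dsimp only at hab hcd; lia))
    have hfinA : (Set.ofPred (· ∈ Prod.fst '' T)).Finite := hfin.image _
    have hcard : hfinA.toFinset.card = T.ncard := by
      rw [← Set.ncard_eq_toFinset_card _ hfinA]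
      exact hinj.ncard_image
    set l := Nat.nth (· ∈ Prod.fst '' T) with hl
    have hmem : ∀ k, ∃ b, k ≤ g → (l k, b) ∈ T := by
      intro k
      by_cases hk : k ≤ g
      · obtain ⟨⟨a, b⟩, hab, h⟩ := Nat.nth_mem (p := (· ∈ Prod.fst '' T)) k (fun _ => by lia)
        exact ⟨b, fun _ => by rwa [hl, ← h]⟩
      · exact ⟨0, fun h => absurd h hk⟩
    choose r hr using hmem
    have hlt : ∀ k < g, l k < l (k + 1) := fun k hk =>
      Nat.nth_lt_nth_of_lt_card hfinA k.lt_succ_self (by lia)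
    refine ⟨l, r, hlt, (hr g le_rfl).1, fun k hk => ?_, (hr 0 g.zero_le).2.1,
      fun k hk => (hr k hk).2.2.trans (hr 0 g.zero_le).2.2.symm⟩
    obtain ⟨h₁, h₂, h₃⟩ := hr k hk.le
    obtain ⟨h₄, h₅, h₆⟩ := hr (k + 1) hk
    dsimp only at h₁ h₂ h₃ h₄ h₅ h₆
    have := hx (h₁.trans h₂) (h₄.trans h₅) (hlt k hk)
    exact (hx.lt_iff_lt h₅ h₂).mp (by lia)
  · rintro ⟨l, r, hl, hlr, hr, hm, hsum⟩ h
    have hlm := strictMonoOn_Iic_of_lt_add_one hl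
    have hra := strictAntiOn_Iic_of_add_one_lt hr
    have hsub : (fun k => (l k, r k)) '' Set.Iic g ⊆
        {p : ℕ × ℕ | p.1 ≤ p.2 ∧ p.2 ≤ m ∧ x p.1 + x p.2 = x (l 0) + x (r 0)} := by
      rintro _ ⟨k, hk, rfl⟩
      exact ⟨((hlm.monotoneOn hk Set.self_mem_Iic hk).trans hlr).trans
        (hra.antitoneOn hk Set.self_mem_Iic hk),
        (hra.antitoneOn g.zero_le hk k.zero_le).trans hm, hsum k hk⟩
    have hcard := (Set.ncard_le_ncard hsub (finite_representations m x _)).trans (h _)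
    rw [Set.InjOn.ncard_image fun a ha b hb hab => hlm.injOn ha hb (congrArg Prod.fst hab),
      Set.ncard_eq_toFinset_card'] at hcard
    simp at hcard

/-- A ruler `x` with successive differences `z` is a `B_2[g]`-set iff there do not exist
indices `ℓ_0 < ℓ_1 < ⋯ < ℓ_g ≤ r_g < r_{g-1} < ⋯ < r_0 ≤ m` such that the `g+1`
quantities `S k = Σ_{i=ℓ_0+1}^{ℓ_k} z_i + Σ_{i=r_g+1}^{r_k} z_i` are all equal. -/
theorem isB2gSet_iff_avoids_subspaces (m g : ℕ) (hm : 1 ≤ m) (hg : 1 ≤ g)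
    (t : ℤ) (x z : ℕ → ℤ) (hx : IsRuler m t x)
    (hz : ∀ i, 1 ≤ i → i ≤ m → z i = x i - x (i - 1)) :
    IsB2gSet m g x ↔
      ¬ ∃ l r : ℕ → ℕ,
        (∀ k < g, l k < l (k + 1)) ∧ l g ≤ r g ∧ (∀ k < g, r (k + 1) < r k) ∧ r 0 ≤ m ∧
        ∀ k ≤ g,
          (∑ i ∈ Finset.Icc (l 0 + 1) (l k), z i) + (∑ i ∈ Finset.Icc (r g + 1) (r k), z i) =
          (∑ i ∈ Finset.Icc (l 0 + 1) (l 0), z i) + (∑ i ∈ Finset.Icc (r g + 1) (r 0), z i) := by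
  rw [iff_not_comm, iff_comm, not_isB2gSet_iff_exists_chain (strictMonoOn_Iic_of_lt_add_one hx.2.2)]
  refine exists_congr fun l => exists_congr fun r => and_congr_right fun hl =>
    and_congr_right fun hlr => and_congr_right fun hr => and_congr_right fun hm =>
      forall₂_congr fun k hk => ?_
  have hlm := (strictMonoOn_Iic_of_lt_add_one hl).monotoneOn
  have hra := (strictAntiOn_Iic_of_add_one_lt hr).antitoneOn
  have h₁ := hlm g.zero_le hk k.zero_le
  have h₂ := hlm hk Set.self_mem_Iic hk
  have h₃ := hra g.zero_le hk k.zero_le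
  have h₄ := hra hk Set.self_mem_Iic hk
  rw [sum_Icc_differences hz h₁ (by lia), sum_Icc_differences hz h₄ (by lia),
    sum_Icc_differences hz le_rfl (by lia), sum_Icc_differences hz (h₄.trans h₃) hm]
  constructor <;> intro h <;> linarith
end
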